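/- arXiv:1003.1004 — 2 statements merged into one kernel-verified Lean document; each statement's English description precedes it below -/
import Mathlib

section
/- Let L be a subspace of E^p and let S := pr_T(L) be its projection to T. Then L is Lagrangian (i.e. L = L^⊥) if and only if the following three conditions hold: (1) L is isotropic; (2) L ∩ ({0} ⊕ ⋀^p T*) = {0} ⊕ ⋀^p S°; (3) either dim S ≤ dim T − p or S = T. -/
open Module

/-- `E^p` for `p = q+1`: the vector space `T ⊕ ⋀^{q+1} T*`. -/
abbrev EP (T : Type) [AddCommGroup T] [Module ℝ T] (q : ℕ) :=
  T × (T [⋀^Fin (q+1)]→ₗ[ℝ] ℝ)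

variable {T : Type} [AddCommGroup T] [Module ℝ T]

/-- The `⋀^q T*`-valued pairing on `E^{q+1}`: `⟨(X,α),(Y,β)⟩ = ι_X β + ι_Y α`. -/
noncomputable def pairing {q : ℕ} (e₁ e₂ : EP T q) : T [⋀^Fin q]→ₗ[ℝ] ℝ :=
  e₂.2.curryLeft e₁.1 + e₁.2.curryLeft e₂.1

def orthSet {q : ℕ} (L : Set (EP T q)) : Set (EP T q) :=
  {e | ∀ l ∈ L, pairing e l = 0}

def IsIsotropic {q : ℕ} (L : Set (EP T q)) : Prop :=
  ∀ e₁ ∈ L, ∀ e₂ ∈ L, pairing e₁ e₂ = 0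

theorem aux_kill {q : ℕ} (α : T [⋀^Fin (q+1)]→ₗ[ℝ] ℝ) (X : T) (h : α.curryLeft X = 0)
    (v : Fin (q+1) → T) (i : Fin (q+1)) (hv : v i = X) : α v = 0 := by
  have h1 : v = i.insertNth X (i.removeNth v) := by
    rw [← hv, Fin.insertNth_self_removeNth]
  have h2 := congrArg (fun f => f (i.removeNth v)) h
  simp only [AlternatingMap.curryLeft_apply_apply, AlternatingMap.zero_apply] at h2
  rw [h1, AlternatingMap.map_insertNth, h2, smul_zero]

theorem aux_swap {q : ℕ} (α : T [⋀^Fin (q+1+1)]→ₗ[ℝ] ℝ) (X Y : T) (w : Fin q → T) :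
    α (Matrix.vecCons X (Matrix.vecCons Y w)) = - α (Matrix.vecCons Y (Matrix.vecCons X w)) := by
  rw [← AlternatingMap.map_swap (i := 0) (j := 1) _ _ (by simp)]
  congr 1
  ext i
  refine Fin.cases ?_ (fun i => ?_) i
  · simp
  · refine Fin.cases ?_ (fun i => ?_) i
    · simp
    · rw [Function.comp_apply, Equiv.swap_apply_of_ne_of_ne]
      · simp
      · exact Fin.succ_ne_zero _
      · exact fun h => Fin.succ_ne_zero _ (Fin.succ_injective _ h)

theorem aux_wedge {q : ℕ} (f : T →ₗ[ℝ] ℝ) (γ : T [⋀^Fin q]→ₗ[ℝ] ℝ) :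
    ∃ δ : T [⋀^Fin (q+1)]→ₗ[ℝ] ℝ, ∀ X, (∀ v i, v i = X → γ v = 0) →
      δ.curryLeft X = f X • γ := by
  refine ⟨AlternatingMap.alternatizeUncurryFin (f.smulRight γ), fun X hX => ?_⟩
  ext v
  rw [AlternatingMap.curryLeft_apply_apply, AlternatingMap.alternatizeUncurryFin_apply,
    Fin.sum_univ_succ, Finset.sum_eq_zero]
  · simp
  · intro i _
    have : γ (i.succ.removeNth (Matrix.vecCons X v)) = 0 := by
      cases q with
      | zero => exact i.elim0
      | succ m =>
        apply hX _ 0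
        simp [Fin.removeNth]
    simp [this]

theorem aux_small [FiniteDimensional ℝ T] {q : ℕ} (S : Submodule ℝ T)
    (hS : finrank ℝ T < finrank ℝ S + (q+1)) (α : T [⋀^Fin (q+1)]→ₗ[ℝ] ℝ)
    (h : ∀ X ∈ S, α.curryLeft X = 0) : α = 0 := by
  ext v
  have hd : ¬ LinearIndependent ℝ (fun i => S.mkQ (v i)) := by
    intro hl
    have h1 := hl.fintype_card_le_finrank
    have h2 := S.finrank_quotient_add_finrank
    simp at h1
    omega
  rw [Fintype.not_linearIndependent_iff] at hd
  obtain ⟨g, hg, j, hj⟩ := hd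
  have hm : ∑ i, g i • v i ∈ S := by
    rw [← Submodule.Quotient.mk_eq_zero, ← Submodule.mkQ_apply, map_sum]
    simpa using hg
  have h0 : α (Function.update v j (∑ i, g i • v i)) = 0 :=
    aux_kill α _ (h _ hm) _ j (by simp)
  rw [AlternatingMap.map_update_sum, Finset.sum_eq_single j] at h0
  · rw [AlternatingMap.map_update_smul, Function.update_eq_self] at h0
    simpa [hj] using h0
  · intro i _ hij
    rw [AlternatingMap.map_update_smul, AlternatingMap.map_update_self _ _ hij.symm, smul_zero]
  · simp

theorem aux_indep {V : Type} [AddCommGroup V] [Module ℝ V] [FiniteDimensional ℝ V]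
    (y : V) (hy : y ≠ 0) (k : ℕ) (hk : k + 1 ≤ finrank ℝ V) :
    ∃ w : Fin (k+1) → V, LinearIndependent ℝ w ∧ w 0 = y := by
  induction k with
  | zero => exact ⟨fun _ => y, by simpa using hy, rfl⟩
  | succ k ih =>
    obtain ⟨w, hw, h0⟩ := ih (by omega)
    obtain ⟨x, hx⟩ := exists_linearIndependent_snoc_of_lt_finrank hw (by omega)
    refine ⟨_, hx, ?_⟩
    rw [← h0]
    exact Fin.snoc_castSucc (α := fun _ => V) x w 0

theorem aux_big [FiniteDimensional ℝ T] {q : ℕ} (S : Submodule ℝ T)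
    (hS : finrank ℝ S + (q+1) ≤ finrank ℝ T) (Y : T) (hY : Y ∉ S) :
    ∃ α : T [⋀^Fin (q+1)]→ₗ[ℝ] ℝ, (∀ X ∈ S, α.curryLeft X = 0) ∧ α.curryLeft Y ≠ 0 := by
  have h2 := S.finrank_quotient_add_finrank
  obtain ⟨w, hw, h0⟩ := aux_indep (S.mkQ Y) (by simpa using hY) q (by omega)
  obtain ⟨g, hg⟩ := LinearMap.exists_leftInverse_of_injective
    (Fintype.linearCombination ℝ w)
    (LinearMap.ker_eq_bot.2 (hw.fintypeLinearCombination_injective))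
  have hgw : ∀ i, g (w i) = Pi.single i 1 := by
    intro i
    have := LinearMap.congr_fun hg (Pi.single i 1)
    simpa [Fintype.linearCombination_apply_single] using this
  choose u hu using fun i => S.mkQ_surjective (w i)
  refine ⟨(Matrix.detRowAlternating (n := Fin (q+1)) (R := ℝ)).compLinearMap (g ∘ₗ S.mkQ), ?_, ?_⟩
  · intro X hX
    ext v
    rw [AlternatingMap.curryLeft_apply_apply, AlternatingMap.zero_apply]
    rw [AlternatingMap.compLinearMap_apply]
    apply AlternatingMap.map_coord_zero (i := 0)
    have : S.mkQ X = 0 := by simpa using hX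
    simp only [Matrix.cons_val_zero, LinearMap.comp_apply, this, map_zero]
  · intro h
    have h1 := congrArg (fun f => f (fun i => u i.succ)) h
    simp only [AlternatingMap.curryLeft_apply_apply, AlternatingMap.zero_apply,
      AlternatingMap.compLinearMap_apply] at h1
    have h3 : (fun i => (g ∘ₗ S.mkQ) (Matrix.vecCons Y (fun i => u i.succ) i))
        = (1 : Matrix (Fin (q+1)) (Fin (q+1)) ℝ) := by
      funext i
      rw [LinearMap.comp_apply]
      have : S.mkQ (Matrix.vecCons Y (fun i => u i.succ) i) = w i := by
        refine Fin.cases ?_ (fun i => ?_) i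
        · simpa using h0.symm
        · simpa using hu i.succ
      rw [this, hgw]
      funext j
      simp [Matrix.one_apply, Pi.single_apply, eq_comm]
    have h4 : Matrix.det (1 : Matrix (Fin (q+1)) (Fin (q+1)) ℝ) = 0 := by
      rw [← h3]; exact h1
    simp at h4

theorem aux_pair_add {q : ℕ} (e a b : EP T q) : pairing e (a + b) = pairing e a + pairing e b := by
  ext v; simp [pairing]; ring

theorem aux_pair_smul {q : ℕ} (e a : EP T q) (c : ℝ) : pairing e (c • a) = c • pairing e a := by
  ext v; simp [pairing]

theorem aux_pair_comm {q : ℕ} (e a : EP T q) : pairing e a = pairing a e := by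
  rw [pairing, pairing, add_comm]

theorem aux_span {q : ℕ} (e : EP T q) (s : Set (EP T q)) (h : ∀ l ∈ s, pairing e l = 0) :
    ∀ l ∈ Submodule.span ℝ s, pairing e l = 0 := by
  intro l hl
  induction hl using Submodule.span_induction with
  | mem x hx => exact h x hx
  | zero => ext v; simp [pairing]
  | add x y _ _ hx hy => rw [aux_pair_add, hx, hy, add_zero]
  | smul c x _ hx => rw [aux_pair_smul, hx, smul_zero]

theorem aux_ext {q : ℕ} (L : Submodule ℝ (EP T q)) (hL : IsIsotropic (L : Set (EP T q)))
    (h0 : ∀ α, ((0, α) : EP T q) ∈ L → α = 0) (Y : T) (s : Finset (EP T q))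
    (hs : ∀ l ∈ s, l ∈ L) :
    ∃ β, ∀ l ∈ s, pairing ((Y, β) : EP T q) l = 0 := by
  classical
  induction s using Finset.induction_on with
  | empty => exact ⟨0, by simp⟩
  | insert e s _ ih =>
    obtain ⟨β, hβ⟩ := ih (fun l hl => hs l (Finset.mem_insert_of_mem hl))
    have heL : e ∈ L := hs e (Finset.mem_insert_self _ _)
    have hsL : Submodule.span ℝ (s : Set (EP T q)) ≤ L :=
      Submodule.span_le.2 fun l hl => hs l (Finset.mem_insert_of_mem hl)
    by_cases hX : e.1 ∈ (Submodule.span ℝ (s : Set (EP T q))).map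
        (LinearMap.fst ℝ T (T [⋀^Fin (q+1)]→ₗ[ℝ] ℝ))
    · obtain ⟨l, hl, hle⟩ := hX
      have hle' : l.1 = e.1 := hle
      have h1 : e - l ∈ L := L.sub_mem heL (hsL hl)
      have h2 : e - l = (0, e.2 - l.2) := by
        ext1
        · simp [hle']
        · rfl
      rw [h2] at h1
      have h3 : e = l := by
        ext1
        · exact hle'.symm
        · exact sub_eq_zero.1 (h0 _ h1)
      have hs' := aux_span _ _ hβ
      refine ⟨β, fun l' hl' => ?_⟩
      rcases Finset.mem_insert.1 hl' with rfl | hl'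
      · rw [h3]; exact hs' l hl
      · exact hβ _ hl'
    · obtain ⟨f, hf, hfe⟩ := LinearMap.exists_extend_of_notMem
        (0 : _ →ₗ[ℝ] ℝ) hX 1
      have hfs : ∀ l ∈ s, f l.1 = 0 := by
        intro l hl
        have := LinearMap.congr_fun hf
          ⟨l.1, Submodule.mem_map.2 ⟨l, Submodule.subset_span hl, rfl⟩⟩
        simpa using this
      obtain ⟨δ, hδ⟩ := aux_wedge f (pairing ((Y, β) : EP T q) e)
      have hc : ∀ v : Fin q → T, pairing ((Y, β) : EP T q) e v =
          e.2 (Matrix.vecCons Y v) + β (Matrix.vecCons e.1 v) := fun v => rfl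
      refine ⟨β - δ, fun l hl => ?_⟩
      have hadd : pairing ((Y, β - δ) : EP T q) l = pairing ((Y, β) : EP T q) l
          - δ.curryLeft l.1 := by
        ext v; simp [pairing]; ring
      rw [hadd]
      rcases Finset.mem_insert.1 hl with rfl | hl
      · rw [hδ, hfe, one_smul, sub_self]
        cases q with
        | zero => exact fun v i => i.elim0
        | succ m =>
          intro v i hv
          refine aux_kill _ l.1 ?_ v i hv
          ext w
          have hi := congrArg (fun f => f (Matrix.vecCons Y w)) (hL l heL l heL)
          simp [pairing] at hi
          rw [AlternatingMap.curryLeft_apply_apply, hc, aux_swap l.2, hi,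
            AlternatingMap.map_eq_zero_of_eq β _ (i := 0) (j := 1) (by simp) (by simp)]
          simp
      · rw [hδ, hfs l hl, hβ l hl, zero_smul, sub_zero]
        cases q with
        | zero => exact fun v i => i.elim0
        | succ m =>
          intro v i hv
          refine aux_kill _ l.1 ?_ v i hv
          ext w
          have hi := congrArg (fun f => f (Matrix.vecCons Y w))
            (hL e heL l (hs l (Finset.mem_insert_of_mem hl)))
          have hj := congrArg (fun f => f (Matrix.vecCons e.1 w)) (hβ l hl)
          simp [pairing] at hi hj
          rw [AlternatingMap.curryLeft_apply_apply, hc, aux_swap e.2, aux_swap β]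
          have := aux_swap l.2 e.1 Y w
          simp only [AlternatingMap.zero_apply]
          linarith

theorem stmt0 [FiniteDimensional ℝ T] (q : ℕ) (hq : q + 1 ≤ finrank ℝ T)
    (L : Submodule ℝ (EP T q)) :
    (L : Set (EP T q)) = orthSet (L : Set (EP T q)) ↔
      (IsIsotropic (L : Set (EP T q)) ∧
       (∀ α : T [⋀^Fin (q+1)]→ₗ[ℝ] ℝ,
          ((0, α) ∈ L ↔
            ∀ X ∈ L.map (LinearMap.fst ℝ T (T [⋀^Fin (q+1)]→ₗ[ℝ] ℝ)),
              α.curryLeft X = 0)) ∧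
       (finrank ℝ (L.map (LinearMap.fst ℝ T (T [⋀^Fin (q+1)]→ₗ[ℝ] ℝ))) ≤
          finrank ℝ T - (q+1) ∨
        L.map (LinearMap.fst ℝ T (T [⋀^Fin (q+1)]→ₗ[ℝ] ℝ)) = ⊤)) := by
  constructor
  · intro h
    have hmem : ∀ e, e ∈ L ↔ ∀ l ∈ L, pairing e l = 0 := fun e => by
      have := Set.ext_iff.1 h e
      exact this
    have hiso : IsIsotropic (L : Set (EP T q)) := fun a ha b hb => (hmem a).1 ha b hb
    have h2 : ∀ α : T [⋀^Fin (q+1)]→ₗ[ℝ] ℝ,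
          ((0, α) ∈ L ↔
            ∀ X ∈ L.map (LinearMap.fst ℝ T (T [⋀^Fin (q+1)]→ₗ[ℝ] ℝ)),
              α.curryLeft X = 0) := by
      intro α
      rw [hmem]
      simp only [Submodule.mem_map, forall_exists_index, and_imp, LinearMap.fst_apply,
        forall_apply_eq_imp_iff₂]
      exact forall₂_congr fun l hl => by simp [pairing]
    refine ⟨hiso, h2, ?_⟩
    by_contra! hcon
    obtain ⟨hc1, hc2⟩ := hcon
    obtain ⟨Y, hY⟩ : ∃ Y, Y ∉ L.map (LinearMap.fst ℝ T (T [⋀^Fin (q+1)]→ₗ[ℝ] ℝ)) := by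
      by_contra! hall
      exact hc2 (eq_top_iff.2 fun x _ => hall x)
    have h0 : ∀ α, ((0, α) : EP T q) ∈ L → α = 0 := fun α hα =>
      aux_small _ (by omega) α ((h2 α).1 hα)
    have hfg : L.FG := by
      have hinj : Function.Injective
          ((LinearMap.fst ℝ T (T [⋀^Fin (q+1)]→ₗ[ℝ] ℝ)).domRestrict L) := by
        apply (injective_iff_map_eq_zero _).2
        rintro ⟨⟨x, α⟩, hm⟩ hx
        have hx' : x = 0 := hx
        subst hx'
        have := h0 _ hm
        subst this
        rfl
      have := Module.Finite.of_injective _ hinj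
      exact Module.Finite.iff_fg.1 this
    obtain ⟨s, hs⟩ := hfg
    obtain ⟨β, hβ⟩ := aux_ext L hiso h0 Y s (fun l hl => hs ▸ Submodule.subset_span hl)
    have : ((Y, β) : EP T q) ∈ L := (hmem _).2 fun l hl =>
      aux_span _ _ hβ l (hs ▸ hl)
    exact hY ⟨_, this, rfl⟩
  · rintro ⟨hiso, h2, h3⟩
    apply Set.Subset.antisymm
    · exact fun e he l hl => hiso e he l hl
    · rintro ⟨Y, β⟩ he
      have hY : Y ∈ L.map (LinearMap.fst ℝ T (T [⋀^Fin (q+1)]→ₗ[ℝ] ℝ)) := by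
        rcases h3 with h3 | h3
        · by_contra hY
          obtain ⟨α, hα, hne⟩ := aux_big (q := q) _ (by omega) Y hY
          apply hne
          have := he _ ((h2 α).2 hα)
          simpa [pairing] using this
        · rw [h3]; trivial
      obtain ⟨⟨Y', γ⟩, hl, hYY⟩ := hY
      have hYY' : Y' = Y := hYY
      subst hYY'
      have hd : ((0, β - γ) : EP T q) ∈ L := by
        rw [h2]
        rintro X ⟨l, hlL, rfl⟩
        have e1 := he l hlL
        have e2 := hiso _ hl l hlL
        ext v
        have e1' := congrArg (fun f => f v) e1
        have e2' := congrArg (fun f => f v) e2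
        simp [pairing] at e1' e2' ⊢
        linarith
      have := L.add_mem hl hd
      simpa using this
end

section
/- Let L be a Lagrangian subspace of E^p and set S := pr_T(L). Then (a) either dim S ≤ dim T − p or S = T, and (b) dim L = dim S + C(dim T − dim S, p), where C(n, p) denotes the binomial coefficient 'n choose p'. -/
open Module

variable {T : Type} [AddCommGroup T] [Module ℝ T]

lemma aux_wedge_s6 {m : ℕ} (ξ : T →ₗ[ℝ] ℝ) (g : T [⋀^Fin (m+1)]→ₗ[ℝ] ℝ) (x : T)
    (hx : g.curryLeft x = 0) :
    (AlternatingMap.alternatizeUncurryFin (ξ.smulRight g)).curryLeft x = ξ x • g := by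
  ext v
  rw [AlternatingMap.curryLeft_apply_apply, AlternatingMap.alternatizeUncurryFin_apply,
    Fin.sum_univ_succ]
  have h : ∀ i : Fin (m+1), g (Fin.removeNth i.succ (Matrix.vecCons x v)) = 0 := by
    intro i
    have : (Fin.removeNth i.succ (Matrix.vecCons x v) : Fin (m+1) → T)
        = Matrix.vecCons x (Fin.removeNth i v) := by
      funext j
      refine Fin.cases ?_ (fun j => ?_) j
      · simp [Fin.removeNth]
      · simp [Fin.removeNth]
    rw [this, ← AlternatingMap.curryLeft_apply_apply, hx]
    rfl
  have h0 : (Fin.removeNth 0 (Matrix.vecCons x v) : Fin (m+1) → T) = v := by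
    funext j
    simp [Fin.removeNth]
  simp [h, h0, -Fin.removeNth_zero]

lemma aux_anti {m : ℕ} (β : T [⋀^Fin (m+2)]→ₗ[ℝ] ℝ) (x y : T) :
    (β.curryLeft x).curryLeft y = - (β.curryLeft y).curryLeft x := by
  have h := AlternatingMap.curryLeft_same β (x + y)
  have h1 := AlternatingMap.curryLeft_same β x
  have h2 := AlternatingMap.curryLeft_same β y
  simp only [map_add, AlternatingMap.curryLeft_add, LinearMap.add_apply, h1, h2] at h
  rw [eq_neg_iff_add_eq_zero]
  simpa [add_comm] using h

lemma aux_ext_s6 {m : ℕ} (γ : T →ₗ[ℝ] T [⋀^Fin (m+1)]→ₗ[ℝ] ℝ) (t : Finset T) :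
    (∀ x ∈ t, ∀ y ∈ t, (γ x).curryLeft y + (γ y).curryLeft x = 0) →
    ∃ β : T [⋀^Fin (m+2)]→ₗ[ℝ] ℝ, ∀ x ∈ t, β.curryLeft x = γ x := by
  classical
  induction t using Finset.induction_on with
  | empty => intro _; exact ⟨0, by simp⟩
  | insert a t _ ih =>
    intro h
    obtain ⟨β, hβ⟩ := ih (fun x hx y hy => h x (Finset.mem_insert_of_mem hx) y
      (Finset.mem_insert_of_mem hy))
    by_cases ha : a ∈ Submodule.span ℝ (t : Set T)
    · refine ⟨β, fun x hx => ?_⟩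
      rcases Finset.mem_insert.1 hx with rfl | hx
      · exact LinearMap.eqOn_span (f := β.curryLeft) (g := γ) (fun y hy => hβ y hy) ha
      · exact hβ x hx
    · obtain ⟨ξ, hξ, hξa⟩ := LinearMap.exists_extend_of_notMem
        (0 : Submodule.span ℝ (t : Set T) →ₗ[ℝ] ℝ) ha 1
      have hξt : ∀ x ∈ t, ξ x = 0 := fun x hx => by
        simpa using congr($hξ ⟨x, Submodule.subset_span hx⟩)
      set g := γ a - β.curryLeft a with hg
      have hcl : ∀ x, g.curryLeft x = (γ a).curryLeft x - (β.curryLeft a).curryLeft x := by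
        intro x; ext v; simp [hg]
      refine ⟨β + AlternatingMap.alternatizeUncurryFin (ξ.smulRight g), fun x hx => ?_⟩
      rw [AlternatingMap.curryLeft_add, LinearMap.add_apply]
      rcases Finset.mem_insert.1 hx with rfl | hx'
      · rw [aux_wedge_s6, hξa, one_smul, hg]
        · abel
        · rw [hcl, AlternatingMap.curryLeft_same, sub_zero]
          have := h x hx x hx
          rwa [← two_smul ℝ, smul_eq_zero_iff_right two_ne_zero] at this
      · rw [aux_wedge_s6, hξt x hx', zero_smul, add_zero, hβ x hx']
        rw [hcl, aux_anti, hβ x hx', sub_neg_eq_add]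
        exact h a (Finset.mem_insert_self _ _) x hx

/-- Forms annihilated by `S`. -/
def annForms (S : Submodule ℝ T) (k : ℕ) : Submodule ℝ (T [⋀^Fin (k+1)]→ₗ[ℝ] ℝ) where
  carrier := {α | ∀ x ∈ S, α.curryLeft x = 0}
  zero_mem' := by intro x _; simp
  add_mem' := by intro a b ha hb x hx; simp [ha x hx, hb x hx]
  smul_mem' := by intro c a ha x hx; simp [ha x hx]

lemma annForms_vanish (S : Submodule ℝ T) (k : ℕ) (α : T [⋀^Fin (k+1)]→ₗ[ℝ] ℝ)
    (hα : α ∈ annForms S k) (v : Fin (k+1) → T) (i : Fin (k+1)) (hi : v i ∈ S) : α v = 0 := by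
  have h0 : ∀ w : Fin (k+1) → T, w 0 ∈ S → α w = 0 := by
    intro w hw
    have := congr($(hα _ hw) (Fin.tail w))
    rw [AlternatingMap.curryLeft_apply_apply] at this
    have e : Matrix.vecCons (w 0) (Fin.tail w) = w := Fin.cons_self_tail w
    rwa [e] at this
  by_cases h : i = 0
  · subst h; exact h0 v hi
  · have := α.map_swap v h
    rw [h0 _ (by simpa using hi)] at this
    simpa using this.symm

lemma annForms_congr (S : Submodule ℝ T) (k : ℕ) (α : T [⋀^Fin (k+1)]→ₗ[ℝ] ℝ)
    (hα : α ∈ annForms S k) (v w : Fin (k+1) → T) (h : ∀ i, v i - w i ∈ S) : α v = α w := by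
  have e : v = w + (v - w) := by simp
  have := α.toMultilinearMap.map_add_univ w (v - w)
  rw [← e] at this
  rw [Finset.sum_eq_single Finset.univ] at this
  · simpa using this
  · intro s _ hs
    obtain ⟨i, hi⟩ : ∃ i, i ∉ s := by
      by_contra! hc
      exact hs (Finset.eq_univ_iff_forall.2 hc)
    refine annForms_vanish S k α hα _ i ?_
    simpa [hi] using h i
  · simp

lemma finrank_alt (V : Type) [AddCommGroup V] [Module ℝ V] [FiniteDimensional ℝ V] (n : ℕ) :
    finrank ℝ (V [⋀^Fin n]→ₗ[ℝ] ℝ) = (finrank ℝ V).choose n := by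
  rw [(exteriorPower.alternatingMapLinearEquiv (R := ℝ) (M := V) (N := ℝ) (n := n)).finrank_eq]
  rw [← exteriorPower.finrank_eq (R := ℝ) (M := V) n]
  exact Subspace.dual_finrank_eq

lemma finrank_annForms [FiniteDimensional ℝ T] (S : Submodule ℝ T) (k : ℕ) :
    finrank ℝ (annForms S k) = (finrank ℝ T - finrank ℝ S).choose (k+1) := by
  have hq : finrank ℝ (T ⧸ S) = finrank ℝ T - finrank ℝ S := by
    have := S.finrank_quotient_add_finrank
    omega
  rw [← hq, ← finrank_alt]
  let Φ : ((T ⧸ S) [⋀^Fin (k+1)]→ₗ[ℝ] ℝ) →ₗ[ℝ] (T [⋀^Fin (k+1)]→ₗ[ℝ] ℝ) :=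
    { toFun := fun f => f.compLinearMap S.mkQ
      map_add' := fun f g => by ext; rfl
      map_smul' := fun c f => by ext; rfl }
  have hinj : Function.Injective Φ :=
    AlternatingMap.compLinearMap_injective _ S.mkQ_surjective
  have hr : LinearMap.range Φ = annForms S k := by
    apply le_antisymm
    · rintro _ ⟨f, rfl⟩ x hx
      change (f.compLinearMap S.mkQ).curryLeft x = 0
      rw [AlternatingMap.curryLeft_compLinearMap, S.mkQ_apply,
        (Submodule.Quotient.mk_eq_zero S).2 hx, map_zero]
      ext; rfl
    · intro α hα
      obtain ⟨s, hs⟩ := S.mkQ.exists_rightInverse_of_surjective S.range_mkQ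
      refine ⟨α.compLinearMap s, ?_⟩
      ext v
      refine annForms_congr S k α hα _ _ fun i => ?_
      rw [← Submodule.Quotient.eq]
      exact congr($hs (S.mkQ (v i)))
  rw [← hr, LinearMap.finrank_range_of_inj hinj]

theorem stmt6 [FiniteDimensional ℝ T] (q : ℕ) (hq : q + 1 ≤ finrank ℝ T)
    (L : Submodule ℝ (EP T q))
    (hLag : (L : Set (EP T q)) = orthSet (L : Set (EP T q))) :
    (finrank ℝ (L.map (LinearMap.fst ℝ T (T [⋀^Fin (q+1)]→ₗ[ℝ] ℝ))) ≤
        finrank ℝ T - (q+1) ∨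
      L.map (LinearMap.fst ℝ T (T [⋀^Fin (q+1)]→ₗ[ℝ] ℝ)) = ⊤) ∧
    finrank ℝ L =
      finrank ℝ (L.map (LinearMap.fst ℝ T (T [⋀^Fin (q+1)]→ₗ[ℝ] ℝ))) +
        Nat.choose
          (finrank ℝ T - finrank ℝ (L.map (LinearMap.fst ℝ T (T [⋀^Fin (q+1)]→ₗ[ℝ] ℝ))))
          (q+1) := by
  set S := L.map (LinearMap.fst ℝ T (T [⋀^Fin (q+1)]→ₗ[ℝ] ℝ)) with hS
  have hmem : ∀ e, e ∈ L ↔ ∀ l ∈ L, pairing e l = 0 := fun e => by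
    change e ∈ (L : Set (EP T q)) ↔ _
    rw [hLag]
    conv_rhs => rw [show (∀ l ∈ L, pairing e l = 0) ↔
      ∀ l ∈ (L : Set (EP T q)), pairing e l = 0 from Iff.rfl, hLag]
    rw [← hLag]
    conv_lhs => rw [hLag]
    rfl
  have hk : ∀ α, ((0, α) : EP T q) ∈ L ↔ α ∈ annForms S q := by
    intro α
    rw [hmem]
    constructor
    · rintro h x ⟨l, hl, rfl⟩
      simpa [pairing] using h l hl
    · intro h l hl
      simpa [pairing] using h l.1 ⟨l, hl, rfl⟩
  have : FiniteDimensional ℝ (T [⋀^Fin (q+1)]→ₗ[ℝ] ℝ) :=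
    (exteriorPower.alternatingMapLinearEquiv (R := ℝ) (M := T) (N := ℝ)
      (n := q+1)).symm.finiteDimensional
  let π : L →ₗ[ℝ] T := (LinearMap.fst ℝ T (T [⋀^Fin (q+1)]→ₗ[ℝ] ℝ)).comp L.subtype
  have hπ : LinearMap.range π = S := by
    rw [LinearMap.range_comp, Submodule.range_subtype]
  have hker : finrank ℝ (LinearMap.ker π) = finrank ℝ (annForms S q) := by
    refine LinearEquiv.finrank_eq (LinearEquiv.ofBijective
      (LinearMap.codRestrict (annForms S q)
        (((LinearMap.snd ℝ T (T [⋀^Fin (q+1)]→ₗ[ℝ] ℝ)).comp L.subtype).comp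
          (LinearMap.ker π).subtype) ?_) ⟨?_, ?_⟩)
    · rintro ⟨⟨⟨x, α⟩, hl⟩, h⟩
      have h' : x = 0 := h
      subst h'
      exact (hk α).1 hl
    · rintro ⟨⟨⟨x, α⟩, hl⟩, h⟩ ⟨⟨⟨x', α'⟩, hl'⟩, h'⟩ e
      have h1 : x = 0 := h
      have h2 : x' = 0 := h'
      have h3 : α = α' := congrArg Subtype.val e
      subst h1 h2 h3
      rfl
    · rintro ⟨α, hα⟩
      exact ⟨⟨⟨(0, α), (hk α).2 hα⟩, rfl⟩, rfl⟩
  refine ⟨?_, ?_⟩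
  swap
  · have hrn := LinearMap.finrank_range_add_finrank_ker (K := ℝ) (V := L) (V₂ := T) π
    rw [hπ, hker, finrank_annForms] at hrn
    exact hrn.symm
  by_contra! hc
  obtain ⟨hc1, hc2⟩ := hc
  have hle : finrank ℝ S < finrank ℝ T := Submodule.finrank_lt hc2
  cases q with
  | zero => omega
  | succ m =>
  have hz : annForms S (m+1) = ⊥ := by
    apply Submodule.finrank_eq_zero.1
    rw [finrank_annForms]
    apply Nat.choose_eq_zero_of_lt
    omega
  obtain ⟨σ, hσ⟩ := π.rangeRestrict.exists_rightInverse_of_surjective π.range_rangeRestrict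
  obtain ⟨τ, hτ⟩ := LinearMap.exists_extend
    (((LinearMap.snd ℝ T (T [⋀^Fin (m+1+1)]→ₗ[ℝ] ℝ)).comp L.subtype).comp σ)
  have hτL : ∀ l ∈ L, l.2 = τ l.1 := by
    intro l hl
    let r : LinearMap.range π := ⟨l.1, ⟨l, hl⟩, rfl⟩
    have h1 : τ l.1 = (σ r : EP T (m+1)).2 := congr($hτ r)
    have h2 : (σ r : EP T (m+1)).1 = l.1 := congrArg Subtype.val congr($hσ r)
    have h3 : ((0, l.2 - (σ r : EP T (m+1)).2) : EP T (m+1)) ∈ L := by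
      have := L.sub_mem hl (σ r).2
      rwa [show l - (σ r : EP T (m+1)) = (0, l.2 - (σ r : EP T (m+1)).2) from
        Prod.ext (by simp [h2]) rfl] at this
    rw [hk, hz, Submodule.mem_bot, sub_eq_zero] at h3
    rw [h1, h3]
  obtain ⟨z, -, hz2⟩ := SetLike.exists_of_lt (lt_top_iff_ne_top.2 hc2)
  obtain ⟨t, ht⟩ := (IsNoetherian.noetherian S)
  have htS : ∀ x ∈ t, (x, τ x) ∈ L := by
    intro x hx
    have : x ∈ S := ht ▸ Submodule.subset_span hx
    obtain ⟨l, hl, rfl⟩ := this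
    have := hτL l hl
    simpa [← this] using hl
  let γ : T →ₗ[ℝ] T [⋀^Fin (m+1)]→ₗ[ℝ] ℝ :=
    -((LinearMap.applyₗ z).comp
      ((AlternatingMap.curryLeftLinearMap (R := ℝ) (M := T) (N := ℝ) (n := m+1)).comp τ))
  have hγ : ∀ x, γ x = -(τ x).curryLeft z := fun x => rfl
  have hneg : ∀ (f : T [⋀^Fin (m+1)]→ₗ[ℝ] ℝ) x, (-f).curryLeft x = - f.curryLeft x :=
    fun f x => by ext; rfl
  obtain ⟨β, hβ⟩ := aux_ext_s6 γ t (by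
    intro x hx y hy
    rw [hγ, hγ, hneg, hneg, aux_anti, aux_anti (τ y)]
    have h := (hmem _).1 (htS x hx) _ (htS y hy)
    have h' : (τ y).curryLeft x + (τ x).curryLeft y = 0 := h
    have h2 : ((τ y).curryLeft x + (τ x).curryLeft y).curryLeft z = 0 := by rw [h']; rfl
    rw [AlternatingMap.curryLeft_add, LinearMap.add_apply] at h2
    rw [neg_neg, neg_neg, add_comm]
    exact h2)
  have hβS : ∀ x ∈ S, β.curryLeft x = γ x := by
    intro x hx
    rw [← ht] at hx
    exact LinearMap.eqOn_span (f := β.curryLeft) (g := γ) (fun y hy => hβ y hy) hx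
  apply hz2
  refine ⟨(z, β), (hmem _).2 fun l hl => ?_, rfl⟩
  change l.2.curryLeft z + β.curryLeft l.1 = 0
  rw [hβS l.1 ⟨l, hl, rfl⟩, hγ, hτL l hl]
  simp
end
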